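/- Let k be an algebraically closed field of characteristic 0. The quotient of the free k-algebra on four generators t₁, t₂, t₃, t₄ by the two-sided ideal generated by the elements t₁t₂ + t₂t₁, t₁t₃ + t₃t₁, t₁t₄ − t₄t₁, t₂t₃ − t₃t₂, t₂t₄ − t₄t₂, t₃t₄ − t₄t₃, t₁² − 1, t₂² − 1, t₃² − 1, t₄² − 1 is isomorphic as a k-algebra to M₂(k) × M₂(k) × M₂(k) × M₂(k), the product of four copies of the algebra of 2×2 matrices over k. -/

import Mathlib

open FreeAlgebra

/-- The quotient of the free `k`-algebra on `Fin m` by the two-sided ideal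
generated by the set `rels` of relators, realized as the `RingQuot` of the
relation identifying each relator with `0`. -/
abbrev presentedAlgebra (k : Type) [Field k] (m : ℕ)
    (rels : Set (FreeAlgebra k (Fin m))) : Type :=
  RingQuot (fun a b : FreeAlgebra k (Fin m) => a ∈ rels ∧ b = 0)

namespace CliffordQuotient

/-- The relations among four generators with square one, the first anticommuting with the second
and third, all other pairs commuting. -/
structure Rels {A : Type*} [Ring A] (a b c d : A) : Prop where
  ab : a * b + b * a = 0
  ac : a * c + c * a = 0
  ad : a * d - d * a = 0
  bc : b * c - c * b = 0
  bd : b * d - d * b = 0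
  cd : c * d - d * c = 0
  aa : a * a - 1 = 0
  bb : b * b - 1 = 0
  cc : c * c - 1 = 0
  dd : d * d - 1 = 0

variable {k : Type} [Field k] {A : Type*} [Ring A] [Algebra k A]

/-- Twice the algebra map from `2 × 2` matrices determined by an anticommuting pair `a`, `b` of
elements with square one. -/
def twiceMatrixMap (a b : A) : Matrix (Fin 2) (Fin 2) k →ₗ[k] A where
  toFun M := M 0 0 • (1 + b) + M 0 1 • ((1 + b) * a) + M 1 0 • ((1 - b) * a) + M 1 1 • (1 - b)
  map_add' M N := by simp only [Matrix.add_apply]; module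
  map_smul' r M := by simp only [Matrix.smul_apply, smul_eq_mul, RingHom.id_apply]; module

theorem twiceMatrixMap_apply (a b : A) (M : Matrix (Fin 2) (Fin 2) k) :
    twiceMatrixMap a b M =
      M 0 0 • (1 + b) + M 0 1 • ((1 + b) * a) + M 1 0 • ((1 - b) * a) + M 1 1 • (1 - b) := rfl

/-- The matrix exchanging the two coordinates. -/
abbrev matX (k : Type) [Field k] : Matrix (Fin 2) (Fin 2) k := !![0, 1; 1, 0]

/-- The diagonal matrix with entries `1` and `-1`. -/
abbrev matZ (k : Type) [Field k] : Matrix (Fin 2) (Fin 2) k := !![1, 0; 0, -1]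

/-- The product of four copies of the algebra of `2 × 2` matrices. -/
abbrev FourMat (k : Type) [Field k] : Type :=
  Matrix (Fin 2) (Fin 2) k × Matrix (Fin 2) (Fin 2) k ×
    Matrix (Fin 2) (Fin 2) k × Matrix (Fin 2) (Fin 2) k

/-- The images of the four generators. -/
def gen (k : Type) [Field k] : Fin 4 → FourMat k :=
  ![(matX k, matX k, matX k, matX k), (matZ k, matZ k, matZ k, matZ k),
    (matZ k, matZ k, -matZ k, -matZ k), (1, -1, 1, -1)]

theorem rels_gen : Rels (gen k 0) (gen k 1) (gen k 2) (gen k 3) := by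
  constructor <;> simp [gen, Matrix.one_fin_two, Prod.ext_iff, ← Matrix.ext_iff]

theorem twiceMatrixMap_matX_mul {a b : A} (ab : a * b = -(b * a)) (aa : a * a = 1)
    (M : Matrix (Fin 2) (Fin 2) k) :
    twiceMatrixMap a b (matX k * M) = a * twiceMatrixMap a b M := by
  have h (x : A) : a * (b * x) = -(b * (a * x)) := by rw [← mul_assoc, ab, neg_mul, mul_assoc]
  simp [twiceMatrixMap_apply, Matrix.vecMul_eq_sum, Fin.sum_univ_two, mul_add, mul_sub, add_mul, sub_mul, ab, aa, h]
  module

theorem twiceMatrixMap_matZ_mul {a b : A} (bb : b * b = 1) (M : Matrix (Fin 2) (Fin 2) k) :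
    twiceMatrixMap a b (matZ k * M) = b * twiceMatrixMap a b M := by
  have h (x : A) : b * (b * x) = x := by rw [← mul_assoc, bb, one_mul]
  simp [twiceMatrixMap_apply, Matrix.vecMul_eq_sum, Fin.sum_univ_two, mul_add, mul_sub, add_mul, sub_mul, bb, h]
  module

theorem commute_twiceMatrixMap {a b x : A} (ha : Commute x a) (hb : Commute x b)
    (M : Matrix (Fin 2) (Fin 2) k) : Commute x (twiceMatrixMap a b M) := by
  have h1 : Commute x (1 + b) := (Commute.one_right x).add_right hb
  have h2 : Commute x (1 - b) := (Commute.one_right x).sub_right hb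
  rw [twiceMatrixMap_apply]
  exact (((h1.smul_right _).add_right ((h1.mul_right ha).smul_right _)).add_right
    ((h2.mul_right ha).smul_right _)).add_right (h2.smul_right _)

/-- The linear map inverse to the algebra map sending the generators to `gen`. -/
def inv (a b c d : A) : FourMat k →ₗ[k] A where
  toFun y := (8⁻¹ : k) •
    (twiceMatrixMap a b y.1 * ((1 + b * c) * (1 + d)) +
      twiceMatrixMap a b y.2.1 * ((1 + b * c) * (1 - d)) +
      twiceMatrixMap a b y.2.2.1 * ((1 - b * c) * (1 + d)) +
      twiceMatrixMap a b y.2.2.2 * ((1 - b * c) * (1 - d)))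
  map_add' y z := by simp only [Prod.fst_add, Prod.snd_add, map_add, add_mul]; module
  map_smul' r y := by
    simp only [Prod.smul_fst, Prod.smul_snd, map_smul, smul_mul_assoc, RingHom.id_apply]; module

theorem inv_apply (a b c d : A) (y : FourMat k) : inv a b c d y = (8⁻¹ : k) •
    (twiceMatrixMap a b y.1 * ((1 + b * c) * (1 + d)) +
      twiceMatrixMap a b y.2.1 * ((1 + b * c) * (1 - d)) +
      twiceMatrixMap a b y.2.2.1 * ((1 - b * c) * (1 + d)) +
      twiceMatrixMap a b y.2.2.2 * ((1 - b * c) * (1 - d))) := rfl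

theorem inv_one [CharZero k] (a b c d : A) : inv a b c d (1 : FourMat k) = 1 := by
  have h : twiceMatrixMap a b (1 : Matrix (Fin 2) (Fin 2) k) = (2 : k) • (1 : A) := by
    simp [twiceMatrixMap_apply]; module
  simp only [inv_apply, Prod.fst_one, Prod.snd_one, h, smul_mul_assoc, one_mul]
  simp only [mul_add, add_mul, mul_sub, sub_mul, mul_one, one_mul]
  match_scalars <;> norm_num

theorem inv_gen_mul {a b c d : A} (r : Rels a b c d) (i : Fin 4) (y : FourMat k) :
    inv a b c d (gen k i * y) = ![a, b, c, d] i * inv a b c d y := by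
  have ab : a * b = -(b * a) := eq_neg_of_add_eq_zero_left r.ab
  have ac : a * c = -(c * a) := eq_neg_of_add_eq_zero_left r.ac
  have ad : a * d = d * a := sub_eq_zero.mp r.ad
  have bc : b * c = c * b := sub_eq_zero.mp r.bc
  have bd : b * d = d * b := sub_eq_zero.mp r.bd
  have cd : c * d = d * c := sub_eq_zero.mp r.cd
  have aa : a * a = 1 := sub_eq_zero.mp r.aa
  have bb : b * b = 1 := sub_eq_zero.mp r.bb
  have cc : c * c = 1 := sub_eq_zero.mp r.cc
  have dd : d * d = 1 := sub_eq_zero.mp r.dd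
  have hza : Commute (b * c) a := by
    rw [commute_iff_eq, mul_assoc, ← mul_assoc a b c, ab, neg_mul, mul_assoc, ac, mul_neg, neg_neg]
  have hzb : Commute (b * c) b := by
    rw [commute_iff_eq, mul_assoc, ← bc]
  have hzz : (b * c) * (b * c) = 1 := by
    rw [← mul_assoc, hzb.eq, ← mul_assoc, bb, one_mul, cc]
  have hdz : d * (b * c) = (b * c) * d := by
    rw [← mul_assoc, ← bd, mul_assoc, ← cd, mul_assoc]
  have hc : c = b * (b * c) := by rw [← mul_assoc, bb, one_mul]
  have hz (M : Matrix (Fin 2) (Fin 2) k) (x : A) :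
      (b * c) * (twiceMatrixMap a b M * x) = twiceMatrixMap a b M * ((b * c) * x) := by
    rw [← mul_assoc, (commute_twiceMatrixMap hza hzb M).eq, mul_assoc]
  have hd (M : Matrix (Fin 2) (Fin 2) k) (x : A) :
      d * (twiceMatrixMap a b M * x) = twiceMatrixMap a b M * (d * x) := by
    rw [← mul_assoc, (commute_twiceMatrixMap ad.symm bd.symm M).eq, mul_assoc]
  have hX := twiceMatrixMap_matX_mul (k := k) ab aa
  have hZ := twiceMatrixMap_matZ_mul (k := k) (a := a) bb
  have zp (x : A) : (b * c) * ((1 + b * c) * x) = (1 + b * c) * x := by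
    rw [← mul_assoc, mul_add, hzz, mul_one, add_comm]
  have zm (x : A) : (b * c) * ((1 - b * c) * x) = -((1 - b * c) * x) := by
    rw [← mul_assoc, mul_sub, hzz, mul_one, ← neg_mul, neg_sub]
  have dp (x : A) (hx : Commute d x) : d * (x * (1 + d)) = x * (1 + d) := by
    rw [← mul_assoc, hx.eq, mul_assoc, mul_add, dd, mul_one, add_comm]
  have dm (x : A) (hx : Commute d x) : d * (x * (1 - d)) = -(x * (1 - d)) := by
    rw [← mul_assoc, hx.eq, mul_assoc, mul_sub, dd, mul_one, ← mul_neg, neg_sub]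
  have hp : Commute d (1 + b * c) := (Commute.one_right d).add_right hdz
  have hm : Commute d (1 - b * c) := (Commute.one_right d).sub_right hdz
  rw [inv_apply, inv_apply, mul_smul_comm]
  congr 1
  fin_cases i
  · change _ = a * _
    simp only [mul_add a, ← mul_assoc a, ← hX]
    rfl
  · change _ = b * _
    simp only [mul_add b, ← mul_assoc b (twiceMatrixMap a b _), ← hZ]
    rfl
  · change _ = c * _
    rw [hc, mul_assoc b (b * c), ← hc]
    simp only [mul_add (b * c), hz, zp, zm, mul_neg]
    simp only [mul_add b, mul_neg, ← mul_assoc b (twiceMatrixMap a b _), ← hZ, ← neg_mul,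
      ← map_neg]
    rfl
  · change _ = d * _
    simp only [mul_add d, hd, dp _ hp, dp _ hm, dm _ hp, dm _ hm]
    simp [gen]

theorem map_twiceMatrixMap {B : Type*} [Ring B] [Algebra k B] (f : A →ₐ[k] B) (a b : A)
    (M : Matrix (Fin 2) (Fin 2) k) :
    f (twiceMatrixMap a b M) = twiceMatrixMap (f a) (f b) M := by
  simp [twiceMatrixMap_apply]

theorem map_inv {B : Type*} [Ring B] [Algebra k B] (f : A →ₐ[k] B) (a b c d : A)
    (y : FourMat k) : f (inv a b c d y) = inv (f a) (f b) (f c) (f d) y := by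
  simp [inv_apply, map_twiceMatrixMap]

theorem inv_gen [CharZero k] (y : FourMat k) :
    inv (gen k 0) (gen k 1) (gen k 2) (gen k 3) y = y := by
  have h (M : Matrix (Fin 2) (Fin 2) k) :
      twiceMatrixMap (gen k 0) (gen k 1) M = (2 : k) • (M, M, M, M) := by
    simp only [twiceMatrixMap_apply, gen, Matrix.cons_val]
    refine Prod.ext ?_ (Prod.ext ?_ (Prod.ext ?_ ?_)) <;>
    · ext i j
      fin_cases i <;> fin_cases j <;> simp [Matrix.one_fin_two] <;> ring
  have hz : gen k 1 * gen k 2 = (1, 1, -1, -1) := by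
    simp [gen, Matrix.one_fin_two]
  have hd : gen k 3 = (1, -1, 1, -1) := rfl
  have h1 : (1 : FourMat k) = (1, 1, 1, 1) := rfl
  have h8 : (8⁻¹ : k) * (2 * 4) = 1 := by norm_num
  rw [inv_apply, hz, hd]
  simp only [h, h1, smul_mul_assoc]
  obtain ⟨p, q, r, s⟩ := y
  refine Prod.ext ?_ (Prod.ext ?_ (Prod.ext ?_ ?_)) <;> simp <;> noncomm_ring <;>
    match_scalars <;> norm_num

/-- An algebra generated by four elements subject to the relations, and with a map to `FourMat k`
sending these elements to `gen`, is isomorphic to `FourMat k`. -/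
theorem bijective_of_rels [CharZero k] {t : Fin 4 → A} (r : Rels (t 0) (t 1) (t 2) (t 3))
    (ht : Algebra.adjoin k (Set.range t) = ⊤) (f : A →ₐ[k] FourMat k)
    (hf : ∀ i, f (t i) = gen k i) : Function.Bijective f := by
  let g : FourMat k →ₗ[k] A := inv (t 0) (t 1) (t 2) (t 3)
  have key (x : A) : ∀ y, g (f x * y) = x * g y := by
    have hx : x ∈ Algebra.adjoin k (Set.range t) := ht ▸ Algebra.mem_top
    induction hx using Algebra.adjoin_induction with
    | mem x hx =>
      obtain ⟨i, rfl⟩ := hx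
      intro y
      rw [hf, inv_gen_mul r]
      congr 1
      fin_cases i <;> rfl
    | algebraMap c => intro y; rw [AlgHom.commutes, ← Algebra.smul_def, map_smul, Algebra.smul_def]
    | add x x' _ _ h h' => intro y; simp [add_mul, h, h']
    | mul x x' _ _ h h' => intro y; simp [mul_assoc, h, h']
  constructor
  · refine Function.LeftInverse.injective (g := g) fun x => ?_
    rw [← mul_one (f x), key, inv_one, mul_one]
  · refine Function.RightInverse.surjective (g := g) fun y => ?_
    rw [map_inv, hf, hf, hf, hf, inv_gen]

end CliffordQuotient

theorem stmt_5 (k : Type) [Field k] [IsAlgClosed k] [CharZero k] :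
    Nonempty (presentedAlgebra k 4
      {ι k 0 * ι k 1 + ι k 1 * ι k 0,
       ι k 0 * ι k 2 + ι k 2 * ι k 0,
       ι k 0 * ι k 3 - ι k 3 * ι k 0,
       ι k 1 * ι k 2 - ι k 2 * ι k 1,
       ι k 1 * ι k 3 - ι k 3 * ι k 1,
       ι k 2 * ι k 3 - ι k 3 * ι k 2,
       ι k 0 * ι k 0 - 1,
       ι k 1 * ι k 1 - 1,
       ι k 2 * ι k 2 - 1,
       ι k 3 * ι k 3 - 1}
      ≃ₐ[k] Matrix (Fin 2) (Fin 2) k × Matrix (Fin 2) (Fin 2) k × Matrix (Fin 2) (Fin 2) k × Matrix (Fin 2) (Fin 2) k) := by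
  set R : Set (FreeAlgebra k (Fin 4)) := {_, _, _, _, _, _, _, _, _, _} with hR
  let π : FreeAlgebra k (Fin 4) →ₐ[k] presentedAlgebra k 4 R := RingQuot.mkAlgHom k _
  have hπ {x} (hx : x ∈ R) : π x = 0 := by
    rw [← map_zero π]
    exact RingQuot.mkAlgHom_rel k ⟨hx, rfl⟩
  have r : CliffordQuotient.Rels (π (ι k 0)) (π (ι k 1)) (π (ι k 2)) (π (ι k 3)) := by
    constructor <;> simp only [← map_mul, ← map_add, ← map_sub, ← map_one π] <;>
      exact hπ (by simp [hR])
  have hrel : ∀ ⦃x y : FreeAlgebra k (Fin 4)⦄, x ∈ R ∧ y = 0 →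
      FreeAlgebra.lift k (CliffordQuotient.gen k) x = FreeAlgebra.lift k (CliffordQuotient.gen k) y := by
    rintro x y ⟨hx, rfl⟩
    have q := CliffordQuotient.rels_gen (k := k)
    rw [hR] at hx
    simp only [Set.mem_insert_iff, Set.mem_singleton_iff] at hx
    rcases hx with rfl | rfl | rfl | rfl | rfl | rfl | rfl | rfl | rfl | rfl <;>
      simp only [map_add, map_sub, map_mul, map_one, map_zero, FreeAlgebra.lift_ι_apply]
    exacts [q.ab, q.ac, q.ad, q.bc, q.bd, q.cd, q.aa, q.bb, q.cc, q.dd]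
  have ht : Algebra.adjoin k (Set.range fun i => π (ι k i)) = ⊤ := by
    have h : (Set.range fun i => π (ι k i)) = π '' Set.range (ι k) := by
      rw [← Set.range_comp]; rfl
    rw [h, ← AlgHom.map_adjoin, FreeAlgebra.adjoin_range_ι, Algebra.map_top,
      AlgHom.range_eq_top]
    exact RingQuot.mkAlgHom_surjective k _
  refine ⟨AlgEquiv.ofBijective (RingQuot.liftAlgHom k ⟨FreeAlgebra.lift k (CliffordQuotient.gen k), hrel⟩)
    (CliffordQuotient.bijective_of_rels (t := fun i => π (ι k i)) r ht _ fun i => ?_)⟩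
  rw [RingQuot.liftAlgHom_mkAlgHom_apply, FreeAlgebra.lift_ι_apply]
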